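/- (Helson–Sarason) Let f : 𝕋 → ℂ be continuous with |f(ζ)| = 1 for all ζ ∈ 𝕋, and let ε > 0. Then there exist finite Blaschke products B₁ and B₂ (with B₂ nonvanishing on 𝕋) such that sup_{ζ ∈ 𝕋} |f(ζ) − B₁(ζ)/B₂(ζ)| < ε. -/

import Mathlib

open Complex Metric Set

/-- The finite Blaschke product with unimodular constant `c` and zeros parameters `a k ∈ 𝔻`. -/
noncomputable def finBlaschke (n : ℕ) (c : ℂ) (a : Fin n → ℂ) : ℂ → ℂ :=
  fun z => c * ∏ k, (a k - z) / (1 - (starRingEnd ℂ) (a k) * z)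

/-- `f` is a finite Blaschke product on the set `s`. -/
def IsFiniteBlaschkeOn (f : ℂ → ℂ) (s : Set ℂ) : Prop :=
  ∃ (n : ℕ) (c : ℂ) (a : Fin n → ℂ),
    ‖c‖ = 1 ∧ (∀ k, ‖a k‖ < 1) ∧ Set.EqOn f (finBlaschke n c a) s

theorem IsFiniteBlaschkeOn.mul {f g : ℂ → ℂ} {s : Set ℂ} (hf : IsFiniteBlaschkeOn f s)
    (hg : IsFiniteBlaschkeOn g s) : IsFiniteBlaschkeOn (f * g) s := by
  obtain ⟨n, c, a, hc, ha, hf⟩ := hf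
  obtain ⟨m, d, b, hd, hb, hg⟩ := hg
  refine ⟨n + m, c * d, Fin.append a b, by simp [hc, hd], fun k => ?_, fun z hz => ?_⟩
  · refine Fin.addCases (fun i => ?_) (fun i => ?_) k
    · simpa using ha i
    · simpa using hb i
  · simp only [Pi.mul_apply, hf hz, hg hz, finBlaschke, Fin.prod_univ_add, Fin.append_left,
      Fin.append_right]
    ring

theorem isFiniteBlaschkeOn_const {c : ℂ} (hc : ‖c‖ = 1) (s : Set ℂ) :
    IsFiniteBlaschkeOn (fun _ => c) s :=
  ⟨0, c, Fin.elim0, hc, fun k => k.elim0, fun z _ => by simp [finBlaschke]⟩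

theorem isFiniteBlaschkeOn_factor {c a : ℂ} (hc : ‖c‖ = 1) (ha : ‖a‖ < 1) (s : Set ℂ) :
    IsFiniteBlaschkeOn (fun z => c * ((a - z) / (1 - (starRingEnd ℂ) a * z))) s :=
  ⟨1, c, fun _ => a, hc, fun _ => ha, fun z _ => by simp [finBlaschke]⟩

theorem isFiniteBlaschkeOn_id (s : Set ℂ) : IsFiniteBlaschkeOn (fun z => z) s := by
  simpa using isFiniteBlaschkeOn_factor (c := -1) (a := 0) (by simp) (by simp) s

theorem IsFiniteBlaschkeOn.ne_zero {f : ℂ → ℂ} (hf : IsFiniteBlaschkeOn f (sphere 0 1))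
    {z : ℂ} (hz : z ∈ sphere (0 : ℂ) 1) : f z ≠ 0 := by
  obtain ⟨n, c, a, hc, ha, hf⟩ := hf
  have hz1 : ‖z‖ = 1 := by simpa using hz
  rw [hf hz, finBlaschke]
  refine mul_ne_zero (norm_ne_zero_iff.1 (by simp [hc])) (Finset.prod_ne_zero_iff.2 fun k _ => ?_)
  refine div_ne_zero (fun h => ?_) (fun h => ?_)
  · exact (ha k).ne (by rw [sub_eq_zero.1 h, hz1])
  · have := congrArg norm (sub_eq_zero.1 h)
    rw [norm_mul, RCLike.norm_conj, hz1, norm_one, mul_one] at this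
    exact (ha k).ne this.symm

/-- The invertible continuous functions on the unit circle. -/
abbrev CircleUnits : Type := C(sphere (0 : ℂ) 1, ℂ)ˣ

namespace CircleUnits

theorem apply_ne_zero (u : CircleUnits) (z : sphere (0 : ℂ) 1) : u.val z ≠ 0 :=
  left_ne_zero_of_mul_eq_one (DFunLike.congr_fun u.mul_inv z)

theorem inv_apply (u : CircleUnits) (z : sphere (0 : ℂ) 1) : u⁻¹.val z = (u.val z)⁻¹ :=
  eq_inv_of_mul_eq_one_right (DFunLike.congr_fun u.mul_inv z)

/-- A nowhere vanishing continuous function on the circle, as a unit. -/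
noncomputable def mk (f : C(sphere (0 : ℂ) 1, ℂ)) (hf : ∀ z, f z ≠ 0) : CircleUnits where
  val := f
  inv := ⟨fun z => (f z)⁻¹, f.continuous.inv₀ hf⟩
  val_inv := by ext z; exact mul_inv_cancel₀ (hf z)
  inv_val := by ext z; exact inv_mul_cancel₀ (hf z)

/-- The coordinate function. -/
noncomputable def coord : CircleUnits :=
  mk ⟨fun z => z, continuous_subtype_val⟩ fun z => ne_zero_of_mem_unit_sphere z

theorem coord_apply (z : sphere (0 : ℂ) 1) : coord.val z = z := rfl

/-- The quotients of finite Blaschke products. -/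
def blaschkeQuotients : Subgroup CircleUnits where
  carrier := {u | ∃ B₁ B₂ : ℂ → ℂ, IsFiniteBlaschkeOn B₁ (sphere (0 : ℂ) 1) ∧
    IsFiniteBlaschkeOn B₂ (sphere (0 : ℂ) 1) ∧ ∀ z, u.val z = B₁ z / B₂ z}
  one_mem' := ⟨_, _, isFiniteBlaschkeOn_const (c := 1) (by simp) _,
    isFiniteBlaschkeOn_const (c := 1) (by simp) _, fun z => by simp⟩
  mul_mem' := by
    rintro u v ⟨B₁, B₂, h₁, h₂, hu⟩ ⟨C₁, C₂, k₁, k₂, hv⟩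
    exact ⟨_, _, h₁.mul k₁, h₂.mul k₂, fun z => by simp [hu, hv, div_mul_div_comm]⟩
  inv_mem' := by
    rintro u ⟨B₁, B₂, h₁, h₂, hu⟩
    exact ⟨B₂, B₁, h₂, h₁, fun z => by rw [inv_apply, hu, inv_div]⟩

theorem coord_mem_blaschkeQuotients : coord ∈ blaschkeQuotients :=
  ⟨_, _, isFiniteBlaschkeOn_id _, isFiniteBlaschkeOn_const (c := 1) (by simp) _,
    fun z => by simp [coord_apply]⟩

/-- The homomorphism `u ↦ u / conj u`. -/
noncomputable def divStar : CircleUnits →* CircleUnits :=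
  MonoidHom.mk' (fun u => u / star u) fun u v => by
    rw [star_mul', mul_div_mul_comm]

theorem divStar_apply (u : CircleUnits) (z : sphere (0 : ℂ) 1) :
    (divStar u).val z = u.val z / (starRingEnd ℂ) (u.val z) := by
  change (u / star u).val z = _
  rw [div_eq_mul_inv, div_eq_mul_inv, Units.val_mul, ContinuousMap.mul_apply, inv_apply]
  rfl

theorem continuous_divStar : Continuous divStar :=
  continuous_id.div' continuous_star

theorem mem_of_eq_eval {D : Subgroup CircleUnits}
    (hconst : ∀ (u : CircleUnits) (c : ℂ), (∀ z, u.val z = c) → u ∈ D)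
    (hlin : ∀ (u : CircleUnits) (a : ℂ), (∀ z, u.val z = z - a) → u ∈ D)
    (p : Polynomial ℂ) (u : CircleUnits) (hu : ∀ z, u.val z = p.eval (z : ℂ)) : u ∈ D := by
  induction hn : p.natDegree generalizing p u with
  | zero =>
    obtain ⟨c, rfl⟩ := Polynomial.natDegree_eq_zero.1 hn
    exact hconst u c (by simpa using hu)
  | succ n ih =>
    have hp : p ≠ 0 := by rintro rfl; simp at hn
    obtain ⟨a, ha⟩ := IsAlgClosed.exists_root p
      (fun h => by simp [Polynomial.natDegree_eq_of_degree_eq_some h] at hn)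
    obtain ⟨q, rfl⟩ := Polynomial.dvd_iff_isRoot.2 ha
    have hne : ∀ z : sphere (0 : ℂ) 1, ((z : ℂ) - a) * q.eval (z : ℂ) ≠ 0 := fun z => by
      have := apply_ne_zero u z
      rw [hu] at this
      simpa using this
    set v : CircleUnits := mk ⟨fun z => (z : ℂ) - a, by fun_prop⟩
      fun z => left_ne_zero_of_mul (hne z)
    set w : CircleUnits := mk ⟨fun z => q.eval (z : ℂ), by fun_prop⟩
      fun z => right_ne_zero_of_mul (hne z)
    have huvw : u = v * w := by
      ext z
      rw [hu]
      simp [v, w, mk]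
    rw [huvw]
    refine D.mul_mem (hlin v a fun z => rfl) (ih q w (fun z => rfl) ?_)
    rw [Polynomial.natDegree_mul (Polynomial.X_sub_C_ne_zero a) (right_ne_zero_of_mul hp),
      Polynomial.natDegree_X_sub_C] at hn
    omega

theorem exists_pow_mul_eq_eval (g : C(sphere (0 : ℂ) 1, ℂ))
    (hg : g ∈ (polynomialFunctions (sphere (0 : ℂ) 1)).starClosure) :
    ∃ (n : ℕ) (p : Polynomial ℂ), ∀ z : sphere (0 : ℂ) 1, (z : ℂ) ^ n * g z = p.eval (z : ℂ) := by
  rw [polynomialFunctions.starClosure_eq_adjoin_X, ← StarSubalgebra.mem_toSubalgebra,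
    StarAlgebra.adjoin_toSubalgebra] at hg
  induction hg using Algebra.adjoin_induction with
  | mem x hx =>
    rcases hx with rfl | hx
    · exact ⟨0, Polynomial.X, fun z => by simp⟩
    · refine ⟨1, 1, fun z => ?_⟩
      have hx' : x = star (Polynomial.toContinuousMapOnAlgHom (sphere (0 : ℂ) 1) Polynomial.X) :=
        (star_eq_iff_star_eq.1 (Set.mem_singleton_iff.1 hx)).symm
      rw [hx']
      simp [Complex.mul_conj, Complex.normSq_eq_norm_sq]
  | algebraMap r => exact ⟨0, Polynomial.C r, fun z => by simp [algebraMap_apply]⟩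
  | add x y _ _ hx hy =>
    obtain ⟨n, p, hp⟩ := hx
    obtain ⟨m, q, hq⟩ := hy
    refine ⟨n + m, Polynomial.X ^ m * p + Polynomial.X ^ n * q, fun z => ?_⟩
    simp only [ContinuousMap.add_apply, Polynomial.eval_add, Polynomial.eval_mul,
      Polynomial.eval_pow, Polynomial.eval_X, ← hp, ← hq]
    ring
  | mul x y _ _ hx hy =>
    obtain ⟨n, p, hp⟩ := hx
    obtain ⟨m, q, hq⟩ := hy
    refine ⟨n + m, p * q, fun z => ?_⟩
    simp only [ContinuousMap.mul_apply, Polynomial.eval_mul, ← hp, ← hq]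
    ring

theorem dense_of_linear_mem {D : Subgroup CircleUnits}
    (hconst : ∀ (u : CircleUnits) (c : ℂ), (∀ z, u.val z = c) → u ∈ D)
    (hlin : ∀ (u : CircleUnits) (a : ℂ), (∀ z, u.val z = z - a) → u ∈ D) :
    Dense (D : Set CircleUnits) := by
  have hd : Dense ((polynomialFunctions (sphere (0 : ℂ) 1)).starClosure :
      Set C(sphere (0 : ℂ) 1, ℂ)) := by
    rw [dense_iff_closure_eq, ← StarSubalgebra.topologicalClosure_coe,
      polynomialFunctions.starClosure_topologicalClosure]
    rfl
  refine (hd.preimage Units.isOpenEmbedding_val.isOpenMap).mono fun u hu => ?_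
  obtain ⟨n, p, hp⟩ := exists_pow_mul_eq_eval u.val hu
  have h : coord ^ n * u ∈ D := mem_of_eq_eval hconst hlin p _ fun z => by
    simp [← hp, coord_apply]
  have hc : coord ∈ D := hlin coord 0 fun z => by simp [coord_apply]
  exact (D.mul_mem_cancel_left (D.pow_mem hc n)).1 h

theorem divStar_mem_blaschkeQuotients_of_const {u : CircleUnits} {c : ℂ}
    (hu : ∀ z, u.val z = c) : divStar u ∈ blaschkeQuotients := by
  have hc : c ≠ 0 := hu ⟨1, by simp⟩ ▸ apply_ne_zero u ⟨1, by simp⟩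
  refine ⟨_, _, isFiniteBlaschkeOn_const (c := c / (starRingEnd ℂ) c) ?_ _,
    isFiniteBlaschkeOn_const (c := 1) (by simp) _, fun z => by simp [divStar_apply, hu]⟩
  simp [hc]

theorem divStar_mem_blaschkeQuotients_of_linear {u : CircleUnits} {a : ℂ}
    (hu : ∀ z, u.val z = z - a) : divStar u ∈ blaschkeQuotients := by
  have hua : ∀ z : sphere (0 : ℂ) 1, (z : ℂ) - a ≠ 0 := fun z => hu z ▸ apply_ne_zero u z
  have hconj : ∀ z : sphere (0 : ℂ) 1, (starRingEnd ℂ) (z : ℂ) = (z : ℂ)⁻¹ := fun z =>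
    (Complex.inv_eq_conj (by simp)).symm
  have key : ∀ z : sphere (0 : ℂ) 1, 1 - (starRingEnd ℂ) a * z ≠ 0 := fun z h => by
    apply (map_ne_zero (starRingEnd ℂ)).2 (hua z)
    have hz := ne_zero_of_mem_unit_sphere z
    rw [map_sub, hconj]
    field_simp
    linear_combination h
  have hdiv : ∀ z : sphere (0 : ℂ) 1, (divStar u).val z =
      z * ((z - a) / (1 - (starRingEnd ℂ) a * z)) := fun z => by
    have hz := ne_zero_of_mem_unit_sphere z
    have : (starRingEnd ℂ) ((z : ℂ) - a) = (1 - (starRingEnd ℂ) a * z) / z := by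
      rw [map_sub, hconj]
      field_simp
    rw [divStar_apply, hu, this]
    have := key z
    field_simp
  have ha : ‖a‖ ≠ 1 := fun h => hua ⟨a, by simpa using h⟩ (sub_self a)
  rcases ha.lt_or_gt with ha | ha
  · refine ⟨_, _, (isFiniteBlaschkeOn_id _).mul
      (isFiniteBlaschkeOn_factor (c := -1) (by simp) ha _),
      isFiniteBlaschkeOn_const (c := 1) (by simp) _, fun z => ?_⟩
    rw [hdiv, Pi.mul_apply]
    ring
  · have ha0 : a ≠ 0 := norm_pos_iff.1 (one_pos.trans ha)
    have ha0' : (starRingEnd ℂ) a ≠ 0 := (map_ne_zero _).2 ha0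
    refine ⟨_, _, (isFiniteBlaschkeOn_id _).mul
      (isFiniteBlaschkeOn_const (c := -(a / (starRingEnd ℂ) a)) (by simp [ha0]) _),
      isFiniteBlaschkeOn_factor (c := 1) (a := ((starRingEnd ℂ) a)⁻¹) (by simp) ?_ _, fun z => ?_⟩
    · simpa using inv_lt_one_of_one_lt₀ ha
    · have h1 := key z
      have h2 : a - z ≠ 0 := fun h => hua z (by linear_combination -h)
      have h3 : (((starRingEnd ℂ) a)⁻¹ - z) / (1 - (starRingEnd ℂ) ((starRingEnd ℂ) a)⁻¹ * z) =
          a / (starRingEnd ℂ) a * ((1 - (starRingEnd ℂ) a * z) / (a - z)) := by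
        rw [map_inv₀, Complex.conj_conj]
        have h4 : 1 - a⁻¹ * z = (a - z) / a := by field_simp
        rw [h4]
        field_simp
      rw [hdiv, Pi.mul_apply, h3]
      field_simp
      ring

theorem divStar_mem_closure (u : CircleUnits) :
    divStar u ∈ blaschkeQuotients.topologicalClosure := by
  have hd : Dense (blaschkeQuotients.comap divStar : Set CircleUnits) :=
    dense_of_linear_mem (fun _ _ h => divStar_mem_blaschkeQuotients_of_const h)
      (fun _ _ h => divStar_mem_blaschkeQuotients_of_linear h)
  exact map_mem_closure continuous_divStar (hd u) fun _ h => h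

/-- The products of a power of the coordinate function and a square. -/
noncomputable def coordPowMulSquares : Subgroup CircleUnits :=
  Subgroup.zpowers coord ⊔ (powMonoidHom 2 : CircleUnits →* CircleUnits).range

theorem sq_mem_coordPowMulSquares (s : CircleUnits) : s ^ 2 ∈ coordPowMulSquares :=
  Subgroup.mem_sup_right ⟨s, rfl⟩

theorem coord_mem_coordPowMulSquares : coord ∈ coordPowMulSquares :=
  Subgroup.mem_sup_left (Subgroup.mem_zpowers coord)

theorem mem_coordPowMulSquares_of_mem_slitPlane {u : CircleUnits}
    (hu : ∀ z, u.val z ∈ slitPlane) : u ∈ coordPowMulSquares := by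
  set s : CircleUnits := mk ⟨fun z => u.val z ^ (2⁻¹ : ℂ),
    u.val.continuous.cpow continuous_const hu⟩ fun z => by simp [apply_ne_zero]
  have : u = s ^ 2 := by
    ext z
    simp only [s, mk, Units.val_pow_eq_pow_val, ContinuousMap.pow_apply, ContinuousMap.coe_mk]
    exact (Complex.cpow_nat_inv_pow _ two_ne_zero).symm
  exact this ▸ sq_mem_coordPowMulSquares s

theorem mem_coordPowMulSquares_of_const {u : CircleUnits} {c : ℂ}
    (hu : ∀ z, u.val z = c) : u ∈ coordPowMulSquares := by
  have hc : c ≠ 0 := hu ⟨1, by simp⟩ ▸ apply_ne_zero u ⟨1, by simp⟩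
  set s : CircleUnits := mk (ContinuousMap.const _ (c ^ (2⁻¹ : ℂ))) fun z => by simp [hc]
  have : u = s ^ 2 := by
    ext z
    simp only [s, mk, Units.val_pow_eq_pow_val, ContinuousMap.pow_apply, ContinuousMap.const_apply,
      hu]
    exact (Complex.cpow_nat_inv_pow _ two_ne_zero).symm
  exact this ▸ sq_mem_coordPowMulSquares s

theorem mem_slitPlane_one_sub {w : ℂ} (hw : ‖w‖ < 1) : 1 - w ∈ slitPlane := by
  simpa [sub_eq_add_neg] using Complex.mem_slitPlane_of_norm_lt_one (z := -w) (by simpa using hw)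

theorem mem_coordPowMulSquares_of_linear {u : CircleUnits} {a : ℂ}
    (hu : ∀ z, u.val z = z - a) : u ∈ coordPowMulSquares := by
  have hua : ∀ z : sphere (0 : ℂ) 1, (z : ℂ) - a ≠ 0 := fun z => hu z ▸ apply_ne_zero u z
  have ha : ‖a‖ ≠ 1 := fun h => hua ⟨a, by simpa using h⟩ (sub_self a)
  rcases ha.lt_or_gt with ha | ha
  · have h : coord⁻¹ * u ∈ coordPowMulSquares := mem_coordPowMulSquares_of_mem_slitPlane fun z => by
      have hz := ne_zero_of_mem_unit_sphere z
      have : (coord⁻¹ * u).val z = 1 - a / z := by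
        simp only [Units.val_mul, ContinuousMap.mul_apply, inv_apply, coord_apply, hu]
        field_simp
      rw [this]
      exact mem_slitPlane_one_sub (by simpa using ha)
    exact (Subgroup.mul_mem_cancel_left _
      (Subgroup.inv_mem _ coord_mem_coordPowMulSquares)).1 h
  · have ha0 : a ≠ 0 := norm_pos_iff.1 (one_pos.trans ha)
    set v : CircleUnits := mk (ContinuousMap.const _ (-a)) fun z => by simpa using ha0
    have hv : v ∈ coordPowMulSquares := mem_coordPowMulSquares_of_const (c := -a) fun z => rfl
    have h : v⁻¹ * u ∈ coordPowMulSquares := mem_coordPowMulSquares_of_mem_slitPlane fun z => by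
      have : (v⁻¹ * u).val z = 1 - z / a := by
        simp only [Units.val_mul, ContinuousMap.mul_apply, inv_apply, hu]
        change (-a)⁻¹ * (z - a) = _
        field_simp
        ring
      rw [this]
      exact mem_slitPlane_one_sub (by simpa using inv_lt_one_of_one_lt₀ ha)
    exact (Subgroup.mul_mem_cancel_left _ (Subgroup.inv_mem _ hv)).1 h

theorem coordPowMulSquares_eq_top : coordPowMulSquares = ⊤ := by
  have hopen : IsOpen (coordPowMulSquares : Set CircleUnits) := by
    refine Subgroup.isOpen_of_mem_nhds _ (g := 1) ?_
    have hmem : Units.val ⁻¹' ball (1 : C(sphere (0 : ℂ) 1, ℂ)) 1 ∈ nhds (1 : CircleUnits) :=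
      Units.continuous_val.continuousAt.preimage_mem_nhds (ball_mem_nhds _ one_pos)
    refine Filter.mem_of_superset hmem fun u hu =>
      mem_coordPowMulSquares_of_mem_slitPlane fun z => ?_
    have h : ‖1 - u.val z‖ < 1 := by
      rw [norm_sub_rev]
      exact ((u.val - 1).norm_coe_le_norm z).trans_lt (mem_ball_iff_norm.1 hu)
    simpa using mem_slitPlane_one_sub h
  have hd : Dense (coordPowMulSquares : Set CircleUnits) :=
    dense_of_linear_mem (fun _ _ h => mem_coordPowMulSquares_of_const h)
      (fun _ _ h => mem_coordPowMulSquares_of_linear h)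
  exact SetLike.coe_injective <|
    (Subgroup.isClosed_of_isOpen _ hopen).closure_eq.symm.trans hd.closure_eq

theorem mul_star_self_eq_one_iff {u : CircleUnits} : u * star u = 1 ↔ ∀ z, ‖u.val z‖ = 1 := by
  have h : ∀ z, (u * star u).val z = ((‖u.val z‖ ^ 2 : ℝ) : ℂ) := fun z => by
    rw [← Complex.normSq_eq_norm_sq, ← Complex.mul_conj]
    rfl
  constructor
  · intro hu z
    have := h z
    rw [hu, Units.val_one, ContinuousMap.one_apply] at this
    exact (pow_eq_one_iff_of_nonneg (norm_nonneg _) two_ne_zero).1 (by exact_mod_cast this.symm)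
  · intro hu
    ext z
    rw [h, hu]
    simp

theorem mem_closure_blaschkeQuotients {u : CircleUnits} (hu : ∀ z, ‖u.val z‖ = 1) :
    u ∈ blaschkeQuotients.topologicalClosure := by
  have hmem : u ∈ coordPowMulSquares := coordPowMulSquares_eq_top ▸ Subgroup.mem_top u
  obtain ⟨_, ⟨k, rfl⟩, _, ⟨s, rfl⟩, rfl⟩ := Subgroup.mem_sup.1 hmem
  change coord ^ k * s ^ 2 ∈ _
  have hc : coord * star coord = 1 := mul_star_self_eq_one_iff.2 fun z => by simp [coord_apply]
  have h1 : coord ^ k * s ^ 2 * star (coord ^ k * s ^ 2) = 1 := mul_star_self_eq_one_iff.2 hu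
  have h2 : s ^ 2 * star (s ^ 2) = 1 := by
    rw [star_mul', mul_mul_mul_comm, star_zpow, ← mul_zpow, hc, one_zpow, one_mul] at h1
    exact h1
  have h3 : s * star s = 1 := mul_star_self_eq_one_iff.2 fun z => by
    have := mul_star_self_eq_one_iff.1 h2 z
    rw [Units.val_pow_eq_pow_val, ContinuousMap.pow_apply, norm_pow] at this
    exact (pow_eq_one_iff_of_nonneg (norm_nonneg _) two_ne_zero).1 this
  have h4 : s ^ 2 = divStar s := by
    change _ = s / star s
    rw [eq_div_iff_mul_eq', sq, mul_assoc, h3, mul_one]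
  rw [h4]
  exact Subgroup.mul_mem _ (Subgroup.zpow_mem _
    (blaschkeQuotients.le_topologicalClosure coord_mem_blaschkeQuotients) k) (divStar_mem_closure s)

end CircleUnits

/-- **Helson–Sarason theorem.** Every continuous unimodular function on the unit circle can be
uniformly approximated by quotients of finite Blaschke products. -/
theorem helson_sarason (f : ℂ → ℂ)
    (hf : ContinuousOn f (sphere (0:ℂ) 1))
    (hu : ∀ ζ ∈ sphere (0:ℂ) 1, ‖f ζ‖ = 1)
    (ε : ℝ) (hε : 0 < ε) :
    ∃ B₁ B₂ : ℂ → ℂ, IsFiniteBlaschkeOn B₁ (sphere (0:ℂ) 1) ∧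
      IsFiniteBlaschkeOn B₂ (sphere (0:ℂ) 1) ∧
      (∀ ζ ∈ sphere (0:ℂ) 1, B₂ ζ ≠ 0) ∧
      ∀ ζ ∈ sphere (0:ℂ) 1, ‖f ζ - B₁ ζ / B₂ ζ‖ < ε := by
  
  set u : CircleUnits := CircleUnits.mk ⟨fun z => f z, hf.domRestrict⟩
    fun z => norm_ne_zero_iff.1 (ne_of_eq_of_ne (hu z z.2) one_ne_zero)
  have hmem : u ∈ closure (CircleUnits.blaschkeQuotients : Set CircleUnits) :=
    CircleUnits.mem_closure_blaschkeQuotients fun z => hu z z.2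
  obtain ⟨v, hv, B₁, B₂, h₁, h₂, hB⟩ := mem_closure_iff.1 hmem (Units.val ⁻¹' ball u.val ε)
    (isOpen_ball.preimage Units.continuous_val) (mem_ball_self hε)
  refine ⟨B₁, B₂, h₁, h₂, fun ζ hζ => h₂.ne_zero hζ, fun ζ hζ => ?_⟩
  rw [← hB ⟨ζ, hζ⟩]
  exact ((u.val - v.val).norm_coe_le_norm ⟨ζ, hζ⟩).trans_lt (mem_ball_iff_norm'.1 hv)
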